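/- For real numbers a, b, E, there exists a nonzero ℓ²-solution of the half-line eigenvalue equation at energy E if and only if either (a = 0 and E² = b² + 1) or (|a| < 1 and E = b). Moreover, in the case a = 0 and E² = b² + 1, the ℂ-vector space of ℓ²-solutions is infinite-dimensional, and in the case |a| < 1 and E = b, it has dimension 1. -/

import Mathlib

open Matrix

noncomputable section

/-- The hopping matrix `A` with rows `(0,1)` and `(0,0)`. -/
def Amat : Matrix (Fin 2) (Fin 2) ℂ := !![0, 1; 0, 0]

/-- The on-site matrix `V` with rows `(b,a)` and `(a,-b)`. -/
def Vmat (a b : ℝ) : Matrix (Fin 2) (Fin 2) ℂ := !![(b : ℂ), (a : ℂ); (a : ℂ), -(b : ℂ)]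

/-- `ψ : ℕ → ℂ²`, where `ψ 0` represents `ψ(1)`, is a solution of the half-line
eigenvalue equation at energy `E`:
`(V - E)ψ(1) + A*ψ(2) = 0` and `Aψ(n) + (V - E)ψ(n+1) + A*ψ(n+2) = 0` for `n ≥ 1`. -/
def IsSol (a b E : ℝ) (ψ : ℕ → EuclideanSpace ℂ (Fin 2)) : Prop :=
  (Vmat a b - (E : ℂ) • 1).mulVec (ψ 0) + (Amat)ᴴ.mulVec (ψ 1) = 0 ∧
  ∀ n : ℕ, Amat.mulVec (ψ n) + (Vmat a b - (E : ℂ) • 1).mulVec (ψ (n + 1))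
      + (Amat)ᴴ.mulVec (ψ (n + 2)) = 0

/-- The ℓ² condition `∑ ‖ψ(n)‖² < ∞`. -/
def IsL2 (ψ : ℕ → EuclideanSpace ℂ (Fin 2)) : Prop :=
  Summable fun n => ‖ψ n‖ ^ 2

end


theorem isSol_iff (a b E : ℝ) (ψ : ℕ → EuclideanSpace ℂ (Fin 2)) :
    IsSol a b E ψ ↔
      ((b - E : ℂ) * ψ 0 0 + a * ψ 0 1 = 0) ∧
      (∀ n, ψ n 1 + (b - E : ℂ) * ψ (n + 1) 0 + a * ψ (n + 1) 1 = 0) ∧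
      (∀ n, a * ψ n 0 - (b + E : ℂ) * ψ n 1 + ψ (n + 1) 0 = 0) := by
  unfold IsSol Vmat Amat
  simp only [funext_iff, Fin.forall_fin_two, Matrix.mulVec, dotProduct, Fin.sum_univ_two,
    Pi.add_apply, Pi.zero_apply, Matrix.sub_apply, Matrix.smul_apply, Matrix.conjTranspose_apply]
  simp
  constructor
  · rintro ⟨⟨h1, h2⟩, h3⟩
    refine ⟨h1, fun n => ?_, fun n => ?_⟩
    · linear_combination (h3 n).1
    · cases n with
      | zero => linear_combination h2
      | succ n => linear_combination (h3 n).2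
  · rintro ⟨h1, h2, h3⟩
    refine ⟨⟨h1, ?_⟩, fun n => ⟨?_, ?_⟩⟩
    · linear_combination h3 0
    · linear_combination h2 n
    · linear_combination h3 (n + 1)

theorem IsL2.tendsto {ψ : ℕ → EuclideanSpace ℂ (Fin 2)} (h : IsL2 ψ) (i : Fin 2) :
    Filter.Tendsto (fun n => ψ n i) Filter.atTop (nhds 0) := by
  have h1 := (Summable.tendsto_atTop_zero h).sqrt
  simp only [Real.sqrt_sq (norm_nonneg _), Real.sqrt_zero] at h1
  exact squeeze_zero_norm (fun n => PiLp.norm_apply_le (ψ n) i) h1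

theorem psi_ext {ψ φ : ℕ → EuclideanSpace ℂ (Fin 2)} (h0 : ∀ n, ψ n 0 = φ n 0)
    (h1 : ∀ n, ψ n 1 = φ n 1) : ψ = φ := by
  funext n
  ext i
  fin_cases i
  · exact h0 n
  · exact h1 n

/-- For `E = b`, a solution has vanishing second component and geometric first component. -/
theorem sol_geom {a b E : ℝ} (hE : E = b) {ψ : ℕ → EuclideanSpace ℂ (Fin 2)}
    (h : IsSol a b E ψ) : (∀ n, ψ n 1 = 0) ∧ ∀ n, ψ n 0 = (-a : ℂ) ^ n * ψ 0 0 := by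
  subst hE
  obtain ⟨h1, h2, h3⟩ := (isSol_iff _ _ _ _).1 h
  have hv : ∀ n, ψ n 1 = 0 := by
    by_cases ha : a = 0
    · intro n
      simpa [ha] using h2 n
    · have ha' : (a : ℂ) ≠ 0 := by exact_mod_cast ha
      intro n
      induction n with
      | zero => simpa [ha] using h1
      | succ n ih => simpa [ha, ih] using h2 n
  refine ⟨hv, fun n => ?_⟩
  induction n with
  | zero => simp
  | succ n ih =>
    have := h3 n
    rw [hv n, ih] at this
    rw [pow_succ]
    linear_combination this

/-- For `a ≠ 0` and `E ≠ b` there is no nonzero decaying solution. -/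
theorem sol_zero {a b E : ℝ} (ha : a ≠ 0) (hE : E ≠ b) {ψ : ℕ → EuclideanSpace ℂ (Fin 2)}
    (h : IsSol a b E ψ) (hl : IsL2 ψ) : ψ = 0 := by
  obtain ⟨h1, h2, h3⟩ := (isSol_iff _ _ _ _).1 h
  have ha' : (a : ℂ) ≠ 0 := by exact_mod_cast ha
  have hd : (b - E : ℂ) ≠ 0 := by
    rw [sub_ne_zero]
    exact_mod_cast hE.symm
  set T : ℂ := (E - b) * (b + E) - 1 - a ^ 2 with hT
  have r0 : a * ψ 1 1 = T * ψ 0 1 := by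
    rw [hT]
    linear_combination h2 0 - (b - E : ℂ) * h3 0 + a * h1
  have r : ∀ n, a * ψ (n + 2) 1 = T * ψ (n + 1) 1 - a * ψ n 1 := by
    intro n
    rw [hT]
    linear_combination h2 (n + 1) - (b - E : ℂ) * h3 (n + 1) + a * h2 n
  have hQ : ∀ n, a * ψ (n + 1) 1 ^ 2 - T * ψ (n + 1) 1 * ψ n 1 + a * ψ n 1 ^ 2
      = a * ψ 0 1 ^ 2 := by
    intro n
    induction n with
    | zero => linear_combination ψ 1 1 * r0
    | succ n ih => linear_combination ih + (ψ (n + 2) 1 - ψ n 1) * r n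
  have hv := hl.tendsto 1
  have hv1 := (Filter.tendsto_add_atTop_iff_nat 1).2 hv
  have hlim := (((hv1.pow 2).const_mul (a : ℂ)).sub ((hv1.const_mul T).mul hv)).add
    ((hv.pow 2).const_mul (a : ℂ))
  have hz : (a : ℂ) * ψ 0 1 ^ 2 = 0 := by
    refine tendsto_nhds_unique (tendsto_const_nhds (f := Filter.atTop (α := ℕ))) ?_
    refine Filter.Tendsto.congr hQ ?_
    simpa using hlim
  have v0 : ψ 0 1 = 0 := by simpa [ha'] using hz
  have u0 : ψ 0 0 = 0 := by simpa [v0, hd] using h1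
  have key : ∀ n, ψ n 0 = 0 ∧ ψ n 1 = 0 := by
    intro n
    induction n with
    | zero => exact ⟨u0, v0⟩
    | succ n ih =>
      have hu : ψ (n + 1) 0 = 0 := by simpa [ih.1, ih.2] using h3 n
      exact ⟨hu, by simpa [ih.2, hu, ha'] using h2 n⟩
  exact psi_ext (fun n => (key n).1) (fun n => (key n).2)

theorem sol_zero' {a b E : ℝ} (ha : a = 0) (hE : E ≠ b) (hE2 : E ^ 2 ≠ b ^ 2 + 1)
    {ψ : ℕ → EuclideanSpace ℂ (Fin 2)} (h : IsSol a b E ψ) : ψ = 0 := by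
  subst ha
  obtain ⟨h1, h2, h3⟩ := (isSol_iff _ _ _ _).1 h
  have hd : (b - E : ℂ) ≠ 0 := by
    rw [sub_ne_zero]
    exact_mod_cast hE.symm
  have hc : (E ^ 2 - (b ^ 2 + 1) : ℂ) ≠ 0 := by
    rw [sub_ne_zero]
    exact_mod_cast hE2
  have hv : ∀ n, ψ n 1 = 0 := by
    intro n
    have : (E ^ 2 - (b ^ 2 + 1) : ℂ) * ψ n 1 = 0 := by
      have e2 := h2 n
      have e3 := h3 n
      simp only [Complex.ofReal_zero, zero_mul] at e2 e3
      linear_combination (b - E : ℂ) * e3 - e2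
    simpa [hc] using this
  refine psi_ext (fun n => ?_) hv
  cases n with
  | zero => simpa [hd] using h1
  | succ n => simpa [hv] using h3 n

theorem part2 (a b E : ℝ) (ha : a = 0) (hE : E ^ 2 = b ^ 2 + 1) :
      ∃ f : ℕ → (ℕ → EuclideanSpace ℂ (Fin 2)),
        (∀ i, IsSol a b E (f i) ∧ IsL2 (f i)) ∧ LinearIndependent ℂ f := by
  subst ha
  have hE' : (E : ℂ) ^ 2 = b ^ 2 + 1 := by exact_mod_cast hE
  refine ⟨fun i n => !₂[if n = i + 1 then (b + E : ℂ) else 0, if n = i then 1 else 0],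
    fun i => ⟨?_, ?_⟩, ?_⟩
  · rw [isSol_iff]
    refine ⟨by simp, fun n => ?_, fun n => ?_⟩
    · by_cases h : n = i
      · simp [h]
        linear_combination -hE'
      · simp [h]
    · by_cases h : n = i <;> simp [h]
  · refine summable_of_ne_finset_zero (s := {i, i + 1}) ?_
    intro n hn
    simp only [Finset.mem_insert, Finset.mem_singleton, not_or] at hn
    simp [hn.1, hn.2, EuclideanSpace.norm_eq]
  · rw [linearIndependent_iff']
    intro s g hg i hi
    have := congrArg (fun F : ℕ → EuclideanSpace ℂ (Fin 2) => F i 1) hg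
    simpa [Finset.sum_apply, hi] using this

theorem part3 (a b E : ℝ) (ha : |a| < 1) (hE : E = b) :
      ∃ ψ₀ : ℕ → EuclideanSpace ℂ (Fin 2), ψ₀ ≠ 0 ∧ IsSol a b E ψ₀ ∧ IsL2 ψ₀ ∧
        ∀ ψ : ℕ → EuclideanSpace ℂ (Fin 2), IsSol a b E ψ → IsL2 ψ →
          ∃ c : ℂ, ψ = c • ψ₀ := by
  refine ⟨fun n => !₂[(-a : ℂ) ^ n, 0], ?_, ?_, ?_, ?_⟩
  · intro h
    have := congrArg (fun F : ℕ → EuclideanSpace ℂ (Fin 2) => F 0 0) h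
    simp at this
  · rw [isSol_iff]
    refine ⟨by simp [hE], fun n => by simp [hE], fun n => ?_⟩
    simp [pow_succ]
    ring
  · have : Summable fun n : ℕ => (a ^ 2) ^ n :=
      summable_geometric_of_lt_one (sq_nonneg a) (by rwa [sq_lt_one_iff_abs_lt_one])
    refine this.congr fun n => ?_
    rw [EuclideanSpace.norm_sq_eq]
    simp [Fin.sum_univ_two]
    rw [← sq_abs a, ← pow_mul, ← pow_mul, mul_comm n 2]
  · intro ψ h _
    obtain ⟨h1, h2⟩ := sol_geom hE h
    refine ⟨ψ 0 0, psi_ext (fun n => ?_) (fun n => ?_)⟩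
    · simp [h2 n, mul_comm]
    · simp [h1 n]

/-- Full characterization: a nonzero ℓ²-solution at energy `E` exists iff
`(a = 0 ∧ E² = b² + 1)` or `(|a| < 1 ∧ E = b)`.  In the first case the space of
ℓ²-solutions is infinite-dimensional, in the second it has dimension 1. -/
theorem L2_solution_characterization (a b E : ℝ) :
    ((∃ ψ : ℕ → EuclideanSpace ℂ (Fin 2), IsSol a b E ψ ∧ IsL2 ψ ∧ ψ ≠ 0) ↔
      ((a = 0 ∧ E ^ 2 = b ^ 2 + 1) ∨ (|a| < 1 ∧ E = b))) ∧
    (a = 0 → E ^ 2 = b ^ 2 + 1 →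
      ∃ f : ℕ → (ℕ → EuclideanSpace ℂ (Fin 2)),
        (∀ i, IsSol a b E (f i) ∧ IsL2 (f i)) ∧ LinearIndependent ℂ f) ∧
    (|a| < 1 → E = b →
      ∃ ψ₀ : ℕ → EuclideanSpace ℂ (Fin 2), ψ₀ ≠ 0 ∧ IsSol a b E ψ₀ ∧ IsL2 ψ₀ ∧
        ∀ ψ : ℕ → EuclideanSpace ℂ (Fin 2), IsSol a b E ψ → IsL2 ψ →
          ∃ c : ℂ, ψ = c • ψ₀) := by
  refine ⟨⟨?_, ?_⟩, part2 a b E, part3 a b E⟩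
  · rintro ⟨ψ, h, hl, hne⟩
    by_cases hE : E = b
    · right
      refine ⟨?_, hE⟩
      by_contra! ha
      obtain ⟨h1, h2⟩ := sol_geom hE h
      apply hne
      have hu : ψ 0 0 = 0 := by
        have ht := (hl.tendsto 0).norm
        rw [norm_zero] at ht
        have : ‖ψ 0 0‖ ≤ 0 := by
          refine ge_of_tendsto' ht fun n => ?_
          rw [h2 n, norm_mul, norm_pow, norm_neg, Complex.norm_real, Real.norm_eq_abs]
          exact le_mul_of_one_le_left (norm_nonneg _) (one_le_pow₀ ha)
        simpa using this
      exact psi_ext (fun n => by simp [h2 n, hu]) h1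
    · left
      by_cases ha : a = 0
      · refine ⟨ha, ?_⟩
        by_contra hE2
        exact hne (sol_zero' ha hE hE2 h)
      · exact absurd (sol_zero ha hE h hl) hne
  · rintro (⟨ha, hE⟩ | ⟨ha, hE⟩)
    · obtain ⟨f, hf, hli⟩ := part2 a b E ha hE
      exact ⟨f 0, (hf 0).1, (hf 0).2, hli.ne_zero 0⟩
    · obtain ⟨ψ, h0, h1, h2, _⟩ := part3 a b E ha hE
      exact ⟨ψ, h1, h2, h0⟩
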